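/- arXiv:1506.00728 — 5 statements merged into one kernel-verified Lean document; each statement's English description precedes it below -/
import Mathlib

section
/- Fix n ≥ 2, a vector b : Fin n → ℝ, constants c > 0, μ > 0, and p ∈ (0,1). Fix indices i ≠ j, a symmetric {0,1}-matrix pair G⁰, G¹ agreeing in all entries except G¹_{ij} = G¹_{ji} = 1 and G⁰_{ij} = G⁰_{ji} = 0, and a fixed assignment η' of {0,1}-values to all coordinates other than i and j. For a, b' ∈ {0,1} let η^{ab'} denote the configuration equal to η' off {i,j} with i-th coordinate a and j-th coordinate b'. Define N(z, z') = Σ_{a,b'∈{0,1}} p · (w(η^{ab'}, G¹)/Z(G¹)) · φ_{μa}(z) · φ_{μb'}(z') and D(z, z') = Σ_{a,b'∈{0,1}} [p · w(η^{ab'}, G¹)/Z(G¹) + (1−p) · w(η^{ab'}, G⁰)/Z(G⁰)] · φ_{μa}(z) · φ_{μb'}(z'). Then the posterior edge probability F(z, z') = N(z, z')/D(z, z') is a strictly increasing function of z for every fixed z', and a strictly increasing function of z' for every fixed z. -/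
/-- The Ising weight of a configuration `η` for the graph (adjacency matrix) `G`:
`w(η, G) = exp(Σ_k b_k η_k + c · Σ_{k,l} η_k G_{k,l} η_l)`. -/
noncomputable def isingW {n : ℕ} (b : Fin n → ℝ) (c : ℝ) (η : Fin n → ℝ)
    (G : Fin n → Fin n → ℝ) : ℝ :=
  Real.exp ((∑ k, b k * η k) + c * ∑ k, ∑ l, η k * G k l * η l)

/-- The Ising partition function: the sum of `w(η, G)` over all `2^n`
configurations `η ∈ {0,1}^n`. -/
noncomputable def isingZ {n : ℕ} (b : Fin n → ℝ) (c : ℝ)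
    (G : Fin n → Fin n → ℝ) : ℝ :=
  ∑ σ : Fin n → Bool, isingW b c (fun k => if σ k then 1 else 0) G

/-- The density of the normal distribution `N(m, 1)`:
`φ_m(z) = (2π)^{-1/2} exp(−(z−m)²/2)`. -/
noncomputable def gaussPdf (m z : ℝ) : ℝ :=
  (Real.sqrt (2 * Real.pi))⁻¹ * Real.exp (-(z - m) ^ 2 / 2)


theorem aux_gauss_pos (m z : ℝ) : 0 < gaussPdf m z := by
  unfold gaussPdf
  have := Real.pi_pos
  positivity

theorem aux_gauss_lt {μ : ℝ} (hμ : 0 < μ) {x y : ℝ} (h : x < y) :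
    gaussPdf μ x * gaussPdf 0 y < gaussPdf μ y * gaussPdf 0 x := by
  unfold gaussPdf
  have hs : 0 < (Real.sqrt (2 * Real.pi))⁻¹ := by
    have := Real.pi_pos
    positivity
  have key : Real.exp (-(x - μ) ^ 2 / 2) * Real.exp (-(y - 0) ^ 2 / 2) <
      Real.exp (-(y - μ) ^ 2 / 2) * Real.exp (-(x - 0) ^ 2 / 2) := by
    rw [← Real.exp_add, ← Real.exp_add, Real.exp_lt_exp]
    nlinarith [mul_pos hμ (sub_pos.2 h)]
  have := mul_lt_mul_of_pos_left key (mul_pos hs hs)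
  nlinarith [this]

theorem aux_Z_pos {n : ℕ} (b : Fin n → ℝ) (c : ℝ) (G : Fin n → Fin n → ℝ) :
    0 < isingZ b c G := by
  unfold isingZ
  exact Finset.sum_pos (fun _ _ => Real.exp_pos _) Finset.univ_nonempty

theorem aux_W {n : ℕ} (b : Fin n → ℝ) (c : ℝ) (i j : Fin n) (hij : i ≠ j)
    (G0 G1 : Fin n → Fin n → ℝ)
    (hG0sym : ∀ k l, G0 k l = G0 l k) (hG1sym : ∀ k l, G1 k l = G1 l k)
    (hG1ij : G1 i j = 1) (hG0ij : G0 i j = 0)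
    (hagree : ∀ k l, ¬((k = i ∧ l = j) ∨ (k = j ∧ l = i)) → G0 k l = G1 k l)
    (η : Fin n → ℝ) :
    isingW b c η G1 = isingW b c η G0 * Real.exp (2 * c * (η i * η j)) := by
  have hG : ∀ k l, G1 k l = G0 k l + (if k = i then (if l = j then 1 else 0) else 0)
      + (if k = j then (if l = i then 1 else 0) else 0) := by
    intro k l
    by_cases h : (k = i ∧ l = j) ∨ (k = j ∧ l = i)
    · rcases h with ⟨rfl, rfl⟩ | ⟨rfl, rfl⟩
      · simp [hij, hG1ij, hG0ij]
      · rw [hG1sym, hG0sym, hG1ij, hG0ij]; simp [hij.symm]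
    · rw [hagree k l h]
      by_cases h1 : k = i <;> by_cases h2 : l = j <;> by_cases h3 : k = j <;>
        by_cases h4 : l = i <;> simp_all
  have hsum : ∑ k, ∑ l, η k * G1 k l * η l =
      ∑ k, ∑ l, η k * G0 k l * η l + 2 * (η i * η j) := by
    simp only [hG, mul_add, add_mul, Finset.sum_add_distrib]
    have e1 : ∀ i j : Fin n, ∑ k, ∑ l, η k * (if k = i then (if l = j then (1:ℝ) else 0) else 0) * η l
        = η i * η j := by
      intro i j
      rw [Finset.sum_eq_single i, Finset.sum_eq_single j] <;> simp +contextual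
    rw [e1, e1]; ring
  unfold isingW
  rw [hsum, ← Real.exp_add]
  congr 1; ring

theorem aux_alg {P Q u v w t K f0 f1 g0 g1 h0 h1 : ℝ} (hP : 0 < P) (hQ : 0 < Q)
    (hu : 0 < u) (hv : 0 < v) (hw : 0 < w) (ht : 0 < t) (hK : 1 < K)
    (hf0 : 0 < f0) (hf1 : 0 < f1) (hg0 : 0 < g0) (hg1 : 0 < g1) (hh0 : 0 < h0) (hh1 : 0 < h1)
    (h : f1 * g0 < g1 * f0) :
    (P * (u * f0 * h0 + v * f0 * h1 + w * f1 * h0 + t * K * f1 * h1)) /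
      (P * (u * f0 * h0 + v * f0 * h1 + w * f1 * h0 + t * K * f1 * h1) +
        Q * (u * f0 * h0 + v * f0 * h1 + w * f1 * h0 + t * f1 * h1)) <
    (P * (u * g0 * h0 + v * g0 * h1 + w * g1 * h0 + t * K * g1 * h1)) /
      (P * (u * g0 * h0 + v * g0 * h1 + w * g1 * h0 + t * K * g1 * h1) +
        Q * (u * g0 * h0 + v * g0 * h1 + w * g1 * h0 + t * g1 * h1)) := by
  have hK0 : 0 < K := by linarith
  rw [div_lt_div_iff₀ (by positivity) (by positivity)]
  have h2 : 0 < P * Q * (g1 * f0 - f1 * g0) * (u * h0 + v * h1) * (t * (K - 1) * h1) := by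
    have := sub_pos.2 h
    have := sub_pos.2 hK
    positivity
  linarith [h2]

/-- Theorem 1 of the paper: the posterior edge probability
`F(z,z') = N(z,z')/D(z,z')` is strictly increasing in `z` for every fixed `z'`,
and strictly increasing in `z'` for every fixed `z`. Here
`N(z,z') = Σ_{a,b'∈{0,1}} p·(w(η^{ab'},G¹)/Z(G¹))·φ_{μa}(z)·φ_{μb'}(z')` and
`D(z,z') = Σ_{a,b'∈{0,1}} [p·w(η^{ab'},G¹)/Z(G¹) + (1−p)·w(η^{ab'},G⁰)/Z(G⁰)]
·φ_{μa}(z)·φ_{μb'}(z')`, where `η^{ab'}` agrees with `η'` off `{i,j}` and has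
`i`-th coordinate `a`, `j`-th coordinate `b'`. -/
theorem posterior_edge_prob_strictMono {n : ℕ} (hn : 2 ≤ n) (b : Fin n → ℝ)
    (c : ℝ) (hc : 0 < c) (μ : ℝ) (hμ : 0 < μ)
    (p : ℝ) (hp0 : 0 < p) (hp1 : p < 1)
    (i j : Fin n) (hij : i ≠ j)
    (G0 G1 : Fin n → Fin n → ℝ)
    (hG0sym : ∀ k l, G0 k l = G0 l k) (hG1sym : ∀ k l, G1 k l = G1 l k)
    (hG0val : ∀ k l, G0 k l = 0 ∨ G0 k l = 1)
    (hG1val : ∀ k l, G1 k l = 0 ∨ G1 k l = 1)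
    (hG1ij : G1 i j = 1) (hG0ij : G0 i j = 0)
    (hagree : ∀ k l, ¬((k = i ∧ l = j) ∨ (k = j ∧ l = i)) → G0 k l = G1 k l)
    (η' : Fin n → ℝ) (hη' : ∀ k, η' k = 0 ∨ η' k = 1)
    (cfg : ℝ → ℝ → Fin n → ℝ)
    (hcfg : ∀ a b' : ℝ, cfg a b' =
      Function.update (Function.update η' i a) j b')
    (N D : ℝ → ℝ → ℝ)
    (hN : ∀ z z' : ℝ, N z z' =
      ∑ a ∈ ({0, 1} : Finset ℝ), ∑ b' ∈ ({0, 1} : Finset ℝ),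
        p * (isingW b c (cfg a b') G1 / isingZ b c G1) *
          gaussPdf (μ * a) z * gaussPdf (μ * b') z')
    (hD : ∀ z z' : ℝ, D z z' =
      ∑ a ∈ ({0, 1} : Finset ℝ), ∑ b' ∈ ({0, 1} : Finset ℝ),
        (p * (isingW b c (cfg a b') G1 / isingZ b c G1) +
            (1 - p) * (isingW b c (cfg a b') G0 / isingZ b c G0)) *
          gaussPdf (μ * a) z * gaussPdf (μ * b') z') :
    (∀ z' : ℝ, StrictMono fun z : ℝ => N z z' / D z z') ∧
    (∀ z : ℝ, StrictMono fun z' : ℝ => N z z' / D z z') := by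
  have hW := fun a b' => aux_W b c i j hij G0 G1 hG0sym hG1sym hG1ij hG0ij hagree (cfg a b')
  have hi : ∀ a b', cfg a b' i = a := by intro a b'; rw [hcfg]; simp [hij]
  have hj : ∀ a b', cfg a b' j = b' := by intro a b'; rw [hcfg]; simp
  simp only [hi, hj] at hW
  have hpos : ∀ a b', 0 < isingW b c (cfg a b') G0 := fun a b' => Real.exp_pos _
  have hP : 0 < p / isingZ b c G1 := div_pos hp0 (aux_Z_pos b c G1)
  have hQ : 0 < (1 - p) / isingZ b c G0 := div_pos (by linarith) (aux_Z_pos b c G0)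
  have hK : 1 < Real.exp (2 * c) := by
    rw [Real.one_lt_exp_iff]; linarith
  have hne : (0 : ℝ) ∉ ({1} : Finset ℝ) := by simp
  have g := aux_gauss_pos
  refine ⟨fun z' x y hxy => ?_, fun z x y hxy => ?_⟩
  · have key := aux_alg hP hQ (hpos 0 0) (hpos 0 1) (hpos 1 0) (hpos 1 1) hK (g 0 x) (g μ x)
      (g 0 y) (g μ y) (g 0 z') (g μ z') (aux_gauss_lt hμ hxy)
    simp only [hN, hD, Finset.sum_insert hne, Finset.sum_singleton, hW, mul_zero,
      mul_one, Real.exp_zero]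
    refine lt_of_eq_of_lt ?_ (lt_of_lt_of_eq key ?_)
    · congr 1 <;> ring
    · congr 1 <;> ring
  · have key := aux_alg hP hQ (hpos 0 0) (hpos 1 0) (hpos 0 1) (hpos 1 1) hK (g 0 x) (g μ x)
      (g 0 y) (g μ y) (g 0 z) (g μ z) (aux_gauss_lt hμ hxy)
    simp only [hN, hD, Finset.sum_insert hne, Finset.sum_singleton, hW, mul_zero,
      mul_one, Real.exp_zero]
    refine lt_of_eq_of_lt ?_ (lt_of_lt_of_eq key ?_)
    · congr 1 <;> ring
    · congr 1 <;> ring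
end

section
/- Fix n ≥ 2, a vector b : Fin n → ℝ, a constant c > 0, a prior probability p ∈ (0,1), indices i ≠ j, and a symmetric {0,1}-matrix pair G⁰, G¹ agreeing in all entries except G¹_{ij} = G¹_{ji} = 1 and G⁰_{ij} = G⁰_{ji} = 0. For any configuration η ∈ {0,1}^n with η_i = 1 and η_j = 1, the conditional probability of the edge, [p · w(η, G¹)/Z(G¹)] / [p · w(η, G¹)/Z(G¹) + (1−p) · w(η, G⁰)/Z(G⁰)], is strictly greater than p. -/
theorem isingW_edge {n : ℕ} (b : Fin n → ℝ) (c : ℝ) (i j : Fin n) (hij : i ≠ j)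
    (G0 G1 : Fin n → Fin n → ℝ)
    (hG0sym : ∀ k l, G0 k l = G0 l k) (hG1sym : ∀ k l, G1 k l = G1 l k)
    (hG1ij : G1 i j = 1) (hG0ij : G0 i j = 0)
    (hagree : ∀ k l, ¬((k = i ∧ l = j) ∨ (k = j ∧ l = i)) → G0 k l = G1 k l)
    (x : Fin n → ℝ) :
    isingW b c x G1 = Real.exp (2 * c * (x i * x j)) * isingW b c x G0 := by
  have hG : ∀ k l, x k * G1 k l * x l = x k * G0 k l * x l
      + (if k = i then (if l = j then x i * x j else 0) else 0)
      + (if k = j then (if l = i then x i * x j else 0) else 0) := by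
    intro k l
    by_cases h1 : k = i ∧ l = j
    · obtain ⟨rfl, rfl⟩ := h1
      simp [hG1ij, hG0ij, hij]
    · by_cases h2 : k = j ∧ l = i
      · obtain ⟨rfl, rfl⟩ := h2
        rw [hG1sym, hG0sym, hG1ij, hG0ij]
        simp [hij.symm, mul_comm]
      · rw [hagree k l (by tauto)]
        have e1 : (if k = i then (if l = j then x i * x j else 0) else 0) = 0 := by
          rw [← ite_and, if_neg h1]
        have e2 : (if k = j then (if l = i then x i * x j else 0) else 0) = 0 := by
          rw [← ite_and, if_neg h2]
        rw [e1, e2]; ring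
  have hS : ∑ k, ∑ l, x k * G1 k l * x l
      = (∑ k, ∑ l, x k * G0 k l * x l) + 2 * (x i * x j) := by
    simp_rw [hG, Finset.sum_add_distrib]
    have e : ∀ a d : Fin n,
        ∑ k : Fin n, ∑ l : Fin n, (if k = a then (if l = d then x i * x j else 0) else 0)
          = x i * x j := by
      intro a d
      rw [Finset.sum_eq_single a]
      · simp
      · intro k _ hk
        simp [hk]
      · simp
    rw [e, e]; ring
  unfold isingW
  rw [hS, ← Real.exp_add]
  congr 1
  ring

/-- Lemma 1 of the paper, first case: if `η_i = η_j = 1`, the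
posterior edge probability
`[p·w(η,G¹)/Z(G¹)] / [p·w(η,G¹)/Z(G¹) + (1−p)·w(η,G⁰)/Z(G⁰)]` exceeds `p`. -/
theorem posterior_edge_gt_prior {n : ℕ} (hn : 2 ≤ n) (b : Fin n → ℝ)
    (c : ℝ) (hc : 0 < c) (p : ℝ) (hp0 : 0 < p) (hp1 : p < 1)
    (i j : Fin n) (hij : i ≠ j)
    (G0 G1 : Fin n → Fin n → ℝ)
    (hG0sym : ∀ k l, G0 k l = G0 l k) (hG1sym : ∀ k l, G1 k l = G1 l k)
    (hG0val : ∀ k l, G0 k l = 0 ∨ G0 k l = 1)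
    (hG1val : ∀ k l, G1 k l = 0 ∨ G1 k l = 1)
    (hG1ij : G1 i j = 1) (hG0ij : G0 i j = 0)
    (hagree : ∀ k l, ¬((k = i ∧ l = j) ∨ (k = j ∧ l = i)) → G0 k l = G1 k l)
    (η : Fin n → ℝ) (hη : ∀ k, η k = 0 ∨ η k = 1)
    (hi : η i = 1) (hj : η j = 1) :
    p < (p * isingW b c η G1 / isingZ b c G1) /
        (p * isingW b c η G1 / isingZ b c G1 +
          (1 - p) * isingW b c η G0 / isingZ b c G0) := by
  have hW := isingW_edge b c i j hij G0 G1 hG0sym hG1sym hG1ij hG0ij hagree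
  have hpos : ∀ (x : Fin n → ℝ) G, 0 < isingW b c x G := fun x G => Real.exp_pos _
  have hZpos : ∀ G, 0 < isingZ b c G := fun G =>
    Finset.sum_pos (fun σ _ => hpos _ G) Finset.univ_nonempty
  have hZ : isingZ b c G1 < Real.exp (2 * c) * isingZ b c G0 := by
    unfold isingZ
    rw [Finset.mul_sum]
    apply Finset.sum_lt_sum
    · intro σ _
      rw [hW]
      apply mul_le_mul_of_nonneg_right _ (hpos _ _).le
      apply Real.exp_le_exp.mpr
      cases σ i <;> cases σ j <;> simp <;> linarith
    · refine ⟨fun _ => false, Finset.mem_univ _, ?_⟩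
      rw [hW]
      apply mul_lt_mul_of_pos_right _ (hpos _ _)
      apply Real.exp_lt_exp.mpr
      simp [hc]
  have hw : isingW b c η G1 = Real.exp (2 * c) * isingW b c η G0 := by
    rw [hW, hi, hj]; simp
  have key : isingW b c η G0 / isingZ b c G0 < isingW b c η G1 / isingZ b c G1 := by
    rw [div_lt_div_iff₀ (hZpos _) (hZpos _), hw]
    nlinarith [mul_lt_mul_of_pos_left hZ (hpos η G0)]
  have hA : 0 < isingW b c η G0 / isingZ b c G0 := div_pos (hpos _ _) (hZpos _)
  rw [mul_div_assoc p (isingW b c η G1), mul_div_assoc (1 - p) (isingW b c η G0)]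
  generalize isingW b c η G0 / isingZ b c G0 = A at *
  generalize isingW b c η G1 / isingZ b c G1 = B at *
  have hq : 0 < 1 - p := by linarith
  have hB : 0 < B := hA.trans key
  rw [lt_div_iff₀ (by positivity)]
  nlinarith [mul_lt_mul_of_pos_left key (mul_pos hp0 hq)]
end

section
/- Fix n ≥ 2, a vector b : Fin n → ℝ, a constant c > 0, a prior probability p ∈ (0,1), indices i ≠ j, and a symmetric {0,1}-matrix pair G⁰, G¹ agreeing in all entries except G¹_{ij} = G¹_{ji} = 1 and G⁰_{ij} = G⁰_{ji} = 0. For any configuration η ∈ {0,1}^n such that not both η_i = 1 and η_j = 1, the conditional probability of the edge, [p · w(η, G¹)/Z(G¹)] / [p · w(η, G¹)/Z(G¹) + (1−p) · w(η, G⁰)/Z(G⁰)], is strictly less than p. -/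
/-- Lemma 1 of the paper, second case: if not both `η_i = 1` and `η_j = 1`, the
posterior edge probability
`[p·w(η,G¹)/Z(G¹)] / [p·w(η,G¹)/Z(G¹) + (1−p)·w(η,G⁰)/Z(G⁰)]` is strictly less than `p`. -/
theorem posterior_edge_lt_prior {n : ℕ} (hn : 2 ≤ n) (b : Fin n → ℝ)
    (c : ℝ) (hc : 0 < c) (p : ℝ) (hp0 : 0 < p) (hp1 : p < 1)
    (i j : Fin n) (hij : i ≠ j)
    (G0 G1 : Fin n → Fin n → ℝ)
    (hG0sym : ∀ k l, G0 k l = G0 l k) (hG1sym : ∀ k l, G1 k l = G1 l k)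
    (hG0val : ∀ k l, G0 k l = 0 ∨ G0 k l = 1)
    (hG1val : ∀ k l, G1 k l = 0 ∨ G1 k l = 1)
    (hG1ij : G1 i j = 1) (hG0ij : G0 i j = 0)
    (hagree : ∀ k l, ¬((k = i ∧ l = j) ∨ (k = j ∧ l = i)) → G0 k l = G1 k l)
    (η : Fin n → ℝ) (hη : ∀ k, η k = 0 ∨ η k = 1)
    (hnotboth : ¬(η i = 1 ∧ η j = 1)) :
    (p * isingW b c η G1 / isingZ b c G1) /
        (p * isingW b c η G1 / isingZ b c G1 +
          (1 - p) * isingW b c η G0 / isingZ b c G0) < p := by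
  have hG1ji : G1 j i = 1 := by rw [hG1sym, hG1ij]
  have hG0ji : G0 j i = 0 := by rw [hG0sym, hG0ij]
  have hle : ∀ k l, G0 k l ≤ G1 k l := by
    intro k l
    by_cases h : (k = i ∧ l = j) ∨ (k = j ∧ l = i)
    · rcases h with ⟨rfl, rfl⟩ | ⟨rfl, rfl⟩
      · rw [hG1ij, hG0ij]; exact zero_le_one
      · rw [hG1ji, hG0ji]; exact zero_le_one
    · exact (hagree k l h).le
  have hW : isingW b c η G1 = isingW b c η G0 := by
    have h0 : η i = 0 ∨ η j = 0 := by
      rcases hη i with h | h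
      · exact Or.inl h
      · rcases hη j with h' | h'
        · exact Or.inr h'
        · exact absurd ⟨h, h'⟩ hnotboth
    have : ∀ k l, η k * G1 k l * η l = η k * G0 k l * η l := by
      intro k l
      by_cases h : (k = i ∧ l = j) ∨ (k = j ∧ l = i)
      · rcases h with ⟨rfl, rfl⟩ | ⟨rfl, rfl⟩ <;> rcases h0 with h0 | h0 <;> simp [h0]
      · rw [hagree k l h]
    unfold isingW
    simp only [this]
  have hWpos : ∀ (τ : Fin n → ℝ) G, 0 < isingW b c τ G := fun τ G => Real.exp_pos _
  have hZpos : 0 < isingZ b c G0 :=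
    Finset.sum_pos (fun σ _ => hWpos _ _) Finset.univ_nonempty
  have hterm : ∀ (τ : Fin n → ℝ), (∀ k, 0 ≤ τ k) → ∀ k l,
      τ k * G0 k l * τ l ≤ τ k * G1 k l * τ l := fun τ hτ k l =>
    mul_le_mul_of_nonneg_right (mul_le_mul_of_nonneg_left (hle k l) (hτ k)) (hτ l)
  have hZ : isingZ b c G0 < isingZ b c G1 := by
    unfold isingZ
    have hnn : ∀ (σ : Fin n → Bool) k, (0 : ℝ) ≤ (if σ k then 1 else 0) := by
      intro σ k; split_ifs <;> norm_num
    refine Finset.sum_lt_sum (fun σ _ => ?_) ⟨fun _ => true, Finset.mem_univ _, ?_⟩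
    · unfold isingW
      refine Real.exp_le_exp.mpr (add_le_add le_rfl (mul_le_mul_of_nonneg_left ?_ hc.le))
      exact Finset.sum_le_sum fun k _ => Finset.sum_le_sum fun l _ => hterm _ (hnn σ) k l
    · unfold isingW
      refine Real.exp_lt_exp.mpr (add_lt_add_of_le_of_lt le_rfl (mul_lt_mul_of_pos_left ?_ hc))
      refine Finset.sum_lt_sum
        (fun k _ => Finset.sum_le_sum fun l _ => hterm _ (hnn fun _ => true) k l)
        ⟨i, Finset.mem_univ _, ?_⟩
      refine Finset.sum_lt_sum (fun l _ => hterm _ (hnn fun _ => true) i l)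
        ⟨j, Finset.mem_univ _, ?_⟩
      simp [hG0ij, hG1ij]
  rw [hW, mul_div_assoc p (isingW b c η G0) (isingZ b c G1), mul_div_assoc (1 - p) (isingW b c η G0)]
  have hw := hWpos η G0
  have hA : 0 < isingW b c η G0 / isingZ b c G1 := div_pos hw (hZpos.trans hZ)
  have hAB : isingW b c η G0 / isingZ b c G1 < isingW b c η G0 / isingZ b c G0 :=
    div_lt_div_of_pos_left hw hZpos hZ
  generalize isingW b c η G0 / isingZ b c G1 = A at *
  generalize isingW b c η G0 / isingZ b c G0 = B at *
  have hq : 0 < 1 - p := sub_pos.mpr hp1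
  have hB : 0 < B := hA.trans hAB
  rw [div_lt_iff₀ (by positivity)]
  have := mul_pos (mul_pos hp0 hq) (sub_pos.mpr hAB)
  nlinarith
end

section
/- Fix n ≥ 2, a vector b : Fin n → ℝ, a constant c ∈ ℝ, a prior probability p ∈ (0,1), indices i ≠ j, and a symmetric {0,1}-matrix pair G⁰, G¹ agreeing in all entries except G¹_{ij} = G¹_{ji} = 1 and G⁰_{ij} = G⁰_{ji} = 0. For every configuration η ∈ {0,1}^n such that not both η_i = 1 and η_j = 1, the conditional edge probability [p · w(η, G¹)/Z(G¹)] / [p · w(η, G¹)/Z(G¹) + (1−p) · w(η, G⁰)/Z(G⁰)] equals the common value [p · Z(G⁰)] / [p · Z(G⁰) + (1−p) · Z(G¹)]; in particular it is the same for all such configurations η. -/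
/-- for every configuration with not both `η_i = 1` and `η_j = 1`,
the posterior edge probability equals the common value
`[p·Z(G⁰)] / [p·Z(G⁰) + (1−p)·Z(G¹)]`, independent of `η`. -/
theorem posterior_edge_common_value {n : ℕ} (hn : 2 ≤ n) (b : Fin n → ℝ)
    (c : ℝ) (p : ℝ) (hp0 : 0 < p) (hp1 : p < 1)
    (i j : Fin n) (hij : i ≠ j)
    (G0 G1 : Fin n → Fin n → ℝ)
    (hG0sym : ∀ k l, G0 k l = G0 l k) (hG1sym : ∀ k l, G1 k l = G1 l k)
    (hG0val : ∀ k l, G0 k l = 0 ∨ G0 k l = 1)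
    (hG1val : ∀ k l, G1 k l = 0 ∨ G1 k l = 1)
    (hG1ij : G1 i j = 1) (hG0ij : G0 i j = 0)
    (hagree : ∀ k l, ¬((k = i ∧ l = j) ∨ (k = j ∧ l = i)) → G0 k l = G1 k l)
    (η : Fin n → ℝ) (hη : ∀ k, η k = 0 ∨ η k = 1)
    (hnotboth : ¬(η i = 1 ∧ η j = 1)) :
    (p * isingW b c η G1 / isingZ b c G1) /
        (p * isingW b c η G1 / isingZ b c G1 +
          (1 - p) * isingW b c η G0 / isingZ b c G0) =
      (p * isingZ b c G0) / (p * isingZ b c G0 + (1 - p) * isingZ b c G1) := by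
  have hW : isingW b c η G1 = isingW b c η G0 := by
    unfold isingW
    congr 3
    refine Finset.sum_congr rfl fun k _ => Finset.sum_congr rfl fun l _ => ?_
    have h0 : η i = 0 ∨ η j = 0 := by
      rcases hη i with h | h
      · exact Or.inl h
      · rcases hη j with h' | h'
        · exact Or.inr h'
        · exact absurd ⟨h, h'⟩ hnotboth
    by_cases hkl : (k = i ∧ l = j) ∨ (k = j ∧ l = i)
    · rcases hkl with ⟨rfl, rfl⟩ | ⟨rfl, rfl⟩ <;> rcases h0 with h | h <;> simp [h]
    · rw [hagree k l hkl]
  have hZ : ∀ G, 0 < isingZ b c G := fun G =>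
    Finset.sum_pos (fun σ _ => Real.exp_pos _) Finset.univ_nonempty
  have hw : 0 < isingW b c η G0 := Real.exp_pos _
  have z0 := hZ G0
  have z1 := hZ G1
  have hq : 0 < 1 - p := by linarith
  rw [hW]
  generalize isingW b c η G0 = w at *
  generalize isingZ b c G0 = Z0 at *
  generalize isingZ b c G1 = Z1 at *
  generalize 1 - p = q at *
  have h1 : p * w / Z1 + q * w / Z0 ≠ 0 := by positivity
  have h2 : p * Z0 + q * Z1 ≠ 0 := by positivity
  rw [div_eq_div_iff h1 h2]
  field_simp
end

section
/- Fix n ≥ 2, a vector b : Fin n → ℝ, a constant c > 0, indices i ≠ j, and a symmetric {0,1}-matrix pair G⁰, G¹ agreeing in all entries except G¹_{ij} = G¹_{ji} = 1 and G⁰_{ij} = G⁰_{ji} = 0. For every configuration η ∈ {0,1}^n such that not both η_i = 1 and η_j = 1, the normalized Ising probabilities satisfy w(η, G¹)/Z(G¹) < w(η, G⁰)/Z(G⁰). -/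
/-- if not both `η_i = 1` and `η_j = 1`, and `c > 0`, then
`w(η, G¹)/Z(G¹) < w(η, G⁰)/Z(G⁰)`. -/
theorem prob_ratio_not_both_one {n : ℕ} (hn : 2 ≤ n) (b : Fin n → ℝ) (c : ℝ) (hc : 0 < c)
    (i j : Fin n) (hij : i ≠ j)
    (G0 G1 : Fin n → Fin n → ℝ)
    (hG0sym : ∀ k l, G0 k l = G0 l k) (hG1sym : ∀ k l, G1 k l = G1 l k)
    (hG0val : ∀ k l, G0 k l = 0 ∨ G0 k l = 1)
    (hG1val : ∀ k l, G1 k l = 0 ∨ G1 k l = 1)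
    (hG1ij : G1 i j = 1) (hG0ij : G0 i j = 0)
    (hagree : ∀ k l, ¬((k = i ∧ l = j) ∨ (k = j ∧ l = i)) → G0 k l = G1 k l)
    (η : Fin n → ℝ) (hη : ∀ k, η k = 0 ∨ η k = 1)
    (hnotboth : ¬(η i = 1 ∧ η j = 1)) :
    isingW b c η G1 / isingZ b c G1 < isingW b c η G0 / isingZ b c G0 := by
  have hle : ∀ k l, G0 k l ≤ G1 k l := by
    intro k l
    by_cases h : (k = i ∧ l = j) ∨ (k = j ∧ l = i)
    · rcases h with ⟨rfl, rfl⟩ | ⟨rfl, rfl⟩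
      · rw [hG1ij, hG0ij]; exact zero_le_one
      · rw [hG1sym, hG0sym, hG1ij, hG0ij]; exact zero_le_one
    · exact (hagree k l h).le
  have hW : isingW b c η G1 = isingW b c η G0 := by
    have hz : η i = 0 ∨ η j = 0 := by
      rcases hη i with h | h
      · exact Or.inl h
      · rcases hη j with h' | h'
        · exact Or.inr h'
        · exact absurd ⟨h, h'⟩ hnotboth
    have hs : ∑ k, ∑ l, η k * G1 k l * η l = ∑ k, ∑ l, η k * G0 k l * η l := by
      refine Finset.sum_congr rfl fun k _ => Finset.sum_congr rfl fun l _ => ?_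
      by_cases h : (k = i ∧ l = j) ∨ (k = j ∧ l = i)
      · rcases h with ⟨rfl, rfl⟩ | ⟨rfl, rfl⟩ <;> rcases hz with hz | hz <;> simp [hz]
      · rw [hagree k l h]
    unfold isingW
    rw [hs]
  have hpos : 0 < isingZ b c G0 := by
    unfold isingZ isingW
    exact Finset.sum_pos (fun _ _ => Real.exp_pos _) Finset.univ_nonempty
  have hZ : isingZ b c G0 < isingZ b c G1 := by
    unfold isingZ
    refine Finset.sum_lt_sum (fun σ _ => ?_) ⟨fun _ => true, Finset.mem_univ _, ?_⟩
    · unfold isingW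
      refine Real.exp_le_exp.2 (add_le_add le_rfl (mul_le_mul_of_nonneg_left ?_ hc.le))
      refine Finset.sum_le_sum fun k _ => Finset.sum_le_sum fun l _ => ?_
      have := hle k l
      by_cases hk : σ k = true <;> by_cases hl : σ l = true <;> simp [hk, hl, this]
    · unfold isingW
      refine Real.exp_lt_exp.2 (add_lt_add_of_le_of_lt le_rfl (mul_lt_mul_of_pos_left ?_ hc))
      simp only [if_true, one_mul, mul_one]
      refine Finset.sum_lt_sum (fun k _ => Finset.sum_le_sum fun l _ => hle k l)
        ⟨i, Finset.mem_univ _, ?_⟩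
      refine Finset.sum_lt_sum (fun l _ => hle i l) ⟨j, Finset.mem_univ _, ?_⟩
      rw [hG1ij, hG0ij]; exact zero_lt_one
  rw [hW]
  exact div_lt_div_of_pos_left (Real.exp_pos _) hpos hZ
end
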